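/- Let 1 < q < ∞. Then for all x ∈ [0, π_{q/2,q}/2), cos_{2q/(q+2),q}(2^{2/q} x) = ((1 − (sin_{q/2,q}(x))^q) / (1 + (sin_{q/2,q}(x))^q))^{2/q + 1}. -/

import Mathlib

open MeasureTheory Set
open scoped ENNReal

/-- `genF p q y = ∫_0^y (1 - t^q)^(-1/p) dt`, whose inverse is the generalized sine. -/
noncomputable def genF (p q y : ℝ) : ℝ := ∫ t in (0:ℝ)..y, (1 - t ^ q) ^ (-(1 / p))

/-- `genG p q y = ∫_0^y (1 + t^q)^(-1/p) dt`, whose inverse is the generalized hyperbolic sine. -/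
noncomputable def genG (p q y : ℝ) : ℝ := ∫ t in (0:ℝ)..y, (1 + t ^ q) ^ (-(1 / p))

/-- The generalized π, `π_{p,q} = 2∫_0^1 (1 - t^q)^(-1/p) dt`, as an extended real number
(it is `∞` when `q/(q+1) < p ≤ 1`). -/
noncomputable def genPi (p q : ℝ) : ℝ≥0∞ :=
  2 * ∫⁻ t in Ioo (0:ℝ) 1, ENNReal.ofReal ((1 - t ^ q) ^ (-(1 / p)))

/-- The generalized sine `sin_{p,q}`: the inverse of `genF p q`, which maps `[0,1)` onto
`[0, π_{p,q}/2)`. -/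
noncomputable def gsin (p q : ℝ) : ℝ → ℝ := Function.invFunOn (genF p q) (Ico 0 1)

/-- The generalized cosine `cos_{p,q} x = (d/dx) sin_{p,q} x` (one-sided at `x = 0`). -/
noncomputable def gcos (p q x : ℝ) : ℝ := derivWithin (gsin p q) (Ici 0) x

/-- The generalized hyperbolic sine `sinh_{p,q}`: the inverse of `genG p q`, which maps
`[0,∞)` onto `[0, π_{r,q}/2)` where `r = pq/(pq+p-q)`. -/
noncomputable def gsinh (p q : ℝ) : ℝ → ℝ := Function.invFunOn (genG p q) (Ici 0)

/-- The generalized hyperbolic cosine `cosh_{p,q} x = (d/dx) sinh_{p,q} x`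
(one-sided at `x = 0`). -/
noncomputable def gcosh (p q x : ℝ) : ℝ := derivWithin (gsinh p q) (Ici 0) x

section GeneralizedSine

variable {p q y : ℝ}

theorem one_sub_rpow_pos_of_abs_lt_one (hq : 0 < q) (hy : y ∈ Ioo (-1 : ℝ) 1) :
    0 < 1 - y ^ q := by
  have h₁ : |y| ^ q < 1 := Real.rpow_lt_one (abs_nonneg y) (abs_lt.2 hy) hq
  have h₂ := (le_abs_self _).trans (Real.abs_rpow_le_abs_rpow y q)
  linarith

theorem continuousOn_genF_integrand (p : ℝ) (hq : 0 < q) :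
    ContinuousOn (fun t : ℝ => (1 - t ^ q) ^ (-(1 / p))) (Ioo (-1) 1) :=
  (continuousOn_const.sub (Real.continuous_rpow_const hq.le).continuousOn).rpow_const
    fun _ ht => Or.inl (one_sub_rpow_pos_of_abs_lt_one hq ht).ne'

theorem uIcc_zero_subset_Ioo (hy : y ∈ Ioo (-1 : ℝ) 1) : uIcc 0 y ⊆ Ioo (-1 : ℝ) 1 :=
  ordConnected_Ioo.uIcc_subset (by norm_num) hy

theorem hasStrictDerivAt_genF (p : ℝ) (hq : 0 < q) (hy : y ∈ Ioo (-1 : ℝ) 1) :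
    HasStrictDerivAt (genF p q) ((1 - y ^ q) ^ (-(1 / p))) y :=
  intervalIntegral.integral_hasStrictDerivAt_right
    (((continuousOn_genF_integrand p hq).mono (uIcc_zero_subset_Ioo hy)).intervalIntegrable)
    ((continuousOn_genF_integrand p hq).stronglyMeasurableAtFilter isOpen_Ioo y hy)
    ((continuousOn_genF_integrand p hq).continuousAt (isOpen_Ioo.mem_nhds hy))

theorem genF_zero (p q : ℝ) : genF p q 0 = 0 := intervalIntegral.integral_same

theorem continuousOn_genF (p : ℝ) (hq : 0 < q) : ContinuousOn (genF p q) (Ioo (-1) 1) :=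
  fun _ hy => (hasStrictDerivAt_genF p hq hy).hasDerivAt.continuousAt.continuousWithinAt

theorem strictMonoOn_genF (p : ℝ) (hq : 0 < q) : StrictMonoOn (genF p q) (Ioo (-1) 1) := by
  refine strictMonoOn_of_deriv_pos (convex_Ioo _ _) (continuousOn_genF p hq) fun y hy => ?_
  rw [interior_Ioo] at hy
  rw [(hasStrictDerivAt_genF p hq hy).hasDerivAt.deriv]
  exact Real.rpow_pos_of_pos (one_sub_rpow_pos_of_abs_lt_one hq hy) _

theorem Ico_zero_one_subset_Ioo : Ico (0 : ℝ) 1 ⊆ Ioo (-1) 1 :=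
  fun _ hy => ⟨by linarith [hy.1], hy.2⟩

theorem gsin_genF (p : ℝ) (hq : 0 < q) (hy : y ∈ Ico (0 : ℝ) 1) : gsin p q (genF p q y) = y :=
  ((strictMonoOn_genF p hq).injOn.mono Ico_zero_one_subset_Ioo).leftInvOn_invFunOn hy

theorem genF_nonneg (p : ℝ) (hq : 0 < q) (hy : y ∈ Ico (0 : ℝ) 1) : 0 ≤ genF p q y := by
  rw [← genF_zero p q]
  exact (strictMonoOn_genF p hq).monotoneOn (by norm_num) (Ico_zero_one_subset_Ioo hy) hy.1

theorem hasDerivWithinAt_gsin (p : ℝ) (hq : 0 < q) (hy : y ∈ Ico (0 : ℝ) 1) :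
    HasDerivWithinAt (gsin p q) ((1 - y ^ q) ^ (1 / p)) (Ici 0) (genF p q y) := by
  have hy' := Ico_zero_one_subset_Ioo hy
  have hpos := one_sub_rpow_pos_of_abs_lt_one hq hy'
  have hF := hasStrictDerivAt_genF p hq hy'
  have hne : (1 - y ^ q) ^ (-(1 / p)) ≠ 0 := (Real.rpow_pos_of_pos hpos _).ne'
  have hg := (hF.to_localInverse hne).hasDerivAt
  have hgy : hF.localInverse _ _ _ hne (genF p q y) = y :=
    HasStrictFDerivAt.localInverse_apply_image _
  have hmem : ∀ᶠ u in nhds (genF p q y), hF.localInverse _ _ _ hne u ∈ Ioo (-1 : ℝ) 1 :=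
    hg.continuousAt.eventually (by rw [hgy]; exact isOpen_Ioo.mem_nhds hy')
  have hinv : ((1 - y ^ q) ^ (-(1 / p)))⁻¹ = (1 - y ^ q) ^ (1 / p) := by
    rw [Real.rpow_neg hpos.le, inv_inv]
  refine (hg.congr_deriv hinv).hasDerivWithinAt.congr_of_eventuallyEq ?_ ?_
  · filter_upwards [self_mem_nhdsWithin, nhdsWithin_le_nhds hmem,
      nhdsWithin_le_nhds (hF.eventually_right_inverse hne)] with u hu hmu hru
    have h₀ : 0 ≤ hF.localInverse _ _ _ hne u := by
      rw [← (strictMonoOn_genF p hq).le_iff_le (by norm_num) hmu, genF_zero, hru]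
      exact hu
    conv_lhs => rw [← hru]
    exact gsin_genF p hq ⟨h₀, hmu.2⟩
  · rw [hgy, gsin_genF p hq hy]

theorem gcos_genF (p : ℝ) (hq : 0 < q) (hy : y ∈ Ico (0 : ℝ) 1) :
    gcos p q (genF p q y) = (1 - y ^ q) ^ (1 / p) :=
  (hasDerivWithinAt_gsin p hq hy).derivWithin (uniqueDiffOn_Ici 0 _ (genF_nonneg p hq hy))

theorem ofReal_genF (p : ℝ) (hq : 0 < q) (hy : y ∈ Ico (0 : ℝ) 1) :
    ENNReal.ofReal (genF p q y) =
      ∫⁻ t in Ioc 0 y, ENNReal.ofReal ((1 - t ^ q) ^ (-(1 / p))) := by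
  have hy' := Ico_zero_one_subset_Ioo hy
  rw [genF, intervalIntegral.integral_of_le hy.1]
  refine ofReal_integral_eq_lintegral_ofReal
    ((continuousOn_genF_integrand p hq).mono (uIcc_zero_subset_Ioo hy')).intervalIntegrable.1 ?_
  filter_upwards [ae_restrict_mem measurableSet_Ioc] with t ht
  exact Real.rpow_nonneg
    (one_sub_rpow_pos_of_abs_lt_one hq ⟨by linarith [ht.1], by linarith [ht.2, hy.2]⟩).le _

theorem genPi_div_two (p q : ℝ) :
    genPi p q / 2 = ∫⁻ t in Ioo (0 : ℝ) 1, ENNReal.ofReal ((1 - t ^ q) ^ (-(1 / p))) := by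
  rw [genPi, mul_comm, ENNReal.mul_div_cancel_right (by norm_num) (by norm_num)]

theorem exists_lt_genF (p : ℝ) (hq : 0 < q) {x : ℝ} (hx : ENNReal.ofReal x < genPi p q / 2) :
    ∃ y ∈ Ico (0 : ℝ) 1, x < genF p q y := by
  by_contra! hle
  refine hx.not_ge ?_
  obtain ⟨u, hu, hu', hlim⟩ := exists_seq_strictMono_tendsto' (show (0 : ℝ) < 1 by norm_num)
  have hU : Ioo (0 : ℝ) 1 ⊆ ⋃ n, Ioc 0 (u n) := fun t ht => by
    obtain ⟨n, hn⟩ := (hlim.eventually (lt_mem_nhds ht.2)).exists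
    exact mem_iUnion.2 ⟨n, ht.1, hn.le⟩
  have hmono : Monotone fun n => Ioc 0 (u n) :=
    fun _ _ h => Ioc_subset_Ioc_right (hu.monotone h)
  rw [genPi_div_two]
  refine (lintegral_mono_set hU).trans ?_
  rw [setLIntegral_iUnion_of_directed _ hmono.directed_le]
  refine iSup_le fun n => ?_
  have hn : u n ∈ Ico (0 : ℝ) 1 := ⟨(hu' n).1.le, (hu' n).2⟩
  rw [← ofReal_genF p hq hn]
  exact ENNReal.ofReal_le_ofReal (hle _ hn)

theorem exists_genF_eq (p : ℝ) (hq : 0 < q) {x : ℝ} (hx₀ : 0 ≤ x)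
    (hx : ENNReal.ofReal x < genPi p q / 2) : ∃ y ∈ Ico (0 : ℝ) 1, genF p q y = x := by
  obtain ⟨b, hb, hxb⟩ := exists_lt_genF p hq hx
  have hsub : Icc 0 b ⊆ Ico (0 : ℝ) 1 := Icc_subset_Ico_right hb.2
  obtain ⟨y, hy, hyx⟩ := intermediate_value_Icc hb.1
    ((continuousOn_genF p hq).mono (hsub.trans Ico_zero_one_subset_Ioo))
    ⟨(genF_zero p q).trans_le hx₀, hxb.le⟩
  exact ⟨y, hsub hy, hyx⟩

/-- The substitution `s ↦ 2^(2/q) s (1 + s^q)^(-2/q)` relating `sin_{q/2,q}` to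
`sin_{2q/(q+2),q}`. -/
noncomputable def doublingMap (q s : ℝ) : ℝ := 2 ^ (2 / q) * (s * (1 + s ^ q) ^ (-(2 / q)))

theorem one_sub_doublingMap_rpow (hq : 0 < q) {s : ℝ} (hs : 0 ≤ s) :
    1 - doublingMap q s ^ q = ((1 - s ^ q) / (1 + s ^ q)) ^ (2 : ℝ) := by
  have hpos : 0 < 1 + s ^ q := by positivity
  have h : doublingMap q s ^ q = 2 ^ (2 : ℝ) * (s ^ q * (1 + s ^ q) ^ (-2 : ℝ)) := by
    rw [doublingMap, Real.mul_rpow (by positivity) (by positivity),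
      Real.mul_rpow hs (by positivity), ← Real.rpow_mul (by norm_num), ← Real.rpow_mul hpos.le,
      neg_mul, div_mul_cancel₀ _ hq.ne']
  rw [h, Real.rpow_neg hpos.le]
  simp only [Real.rpow_two]
  field_simp
  ring

theorem doublingMap_mem (hq : 0 < q) {s : ℝ} (hs : s ∈ Ico (0 : ℝ) 1) :
    doublingMap q s ∈ Ico (0 : ℝ) 1 := by
  have hs₀ := hs.1
  have h₀ : 0 ≤ doublingMap q s := by unfold doublingMap; positivity
  refine ⟨h₀, ?_⟩
  have h₁ := one_sub_rpow_pos_of_abs_lt_one hq (Ico_zero_one_subset_Ioo hs)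
  have h₂ : 0 < 1 - doublingMap q s ^ q := by
    rw [one_sub_doublingMap_rpow hq hs₀]; positivity
  by_contra! h
  linarith [Real.one_le_rpow h hq.le]

theorem hasDerivAt_doublingMap (hq : 1 < q) {s : ℝ} (hs : 0 ≤ s) :
    HasDerivAt (doublingMap q)
      (2 ^ (2 / q) * ((1 - s ^ q) * (1 + s ^ q) ^ (-(2 / q + 1)))) s := by
  have hpos : 0 < 1 + s ^ q := by positivity
  have hq₀ : q ≠ 0 := by positivity
  have h := ((hasDerivAt_id s).mul (((Real.hasDerivAt_rpow_const (Or.inr hq.le)).const_add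
    1).rpow_const (p := -(2 / q)) (Or.inl hpos.ne'))).const_mul ((2 : ℝ) ^ (2 / q))
  refine h.congr_deriv ?_
  have h₁ : (1 + s ^ q) ^ (-(2 / q)) = (1 + s ^ q) ^ (-(2 / q + 1)) * (1 + s ^ q) := by
    rw [← Real.rpow_add_one hpos.ne']; ring_nf
  have h₂ : s * s ^ (q - 1) = s ^ q := by
    rw [← Real.rpow_one_add' hs (by simpa using hq₀), add_sub_cancel]
  have h₃ : -(2 / q) - 1 = -(2 / q + 1) := by ring
  have h₄ : q * (2 / q) = 2 := by field_simp
  simp only [id, h₁, h₃]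
  linear_combination (2 : ℝ) ^ (2 / q) * (1 + s ^ q) ^ (-(2 / q + 1)) *
    (-q * (2 / q) * h₂ - s ^ q * h₄)

theorem genF_doublingMap (hq : 1 < q) {s : ℝ} (hs : s ∈ Ico (0 : ℝ) 1) :
    genF (2 * q / (q + 2)) q (doublingMap q s) = (2 : ℝ) ^ (2 / q) * genF (q / 2) q s := by
  have hq₀ : 0 < q := by linarith
  have key : ∀ t ∈ Ico (0 : ℝ) 1, HasDerivAt (fun t => genF (2 * q / (q + 2)) q (doublingMap q t) -
      (2 : ℝ) ^ (2 / q) * genF (q / 2) q t) 0 t := by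
    intro t ht
    have hF := (hasStrictDerivAt_genF (2 * q / (q + 2)) hq₀
      (Ico_zero_one_subset_Ioo (doublingMap_mem hq₀ ht))).hasDerivAt.comp t
        (hasDerivAt_doublingMap hq ht.1)
    have hG := (hasStrictDerivAt_genF (q / 2) hq₀
      (Ico_zero_one_subset_Ioo ht)).hasDerivAt.const_mul ((2 : ℝ) ^ (2 / q))
    refine (hF.sub hG).congr_deriv ?_
    have h₁ := one_sub_rpow_pos_of_abs_lt_one hq₀ (Ico_zero_one_subset_Ioo ht)
    have h₂ : 0 < 1 + t ^ q := by have := ht.1; positivity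
    have e₁ : (2 : ℝ) * -(1 / (2 * q / (q + 2))) = -(2 / q + 1) := by field_simp; ring
    have e₂ : -(1 / (q / 2)) = -(2 / q + 1) + 1 := by field_simp; ring
    rw [one_sub_doublingMap_rpow hq₀ ht.1, ← Real.rpow_mul (by positivity), e₁, e₂,
      Real.rpow_add_one h₁.ne', Real.div_rpow h₁.le h₂.le]
    have := (Real.rpow_pos_of_pos h₂ (-(2 / q + 1))).ne'
    field_simp
    ring
  have hsub : Icc 0 s ⊆ Ico (0 : ℝ) 1 := Icc_subset_Ico_right hs.2
  have h := constant_of_has_deriv_right_zero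
    (fun t ht => (key t (hsub ht)).continuousAt.continuousWithinAt)
    (fun t ht => (key t (hsub (Ico_subset_Icc_self ht))).hasDerivWithinAt) s
    (right_mem_Icc.2 hs.1)
  have h₀ : doublingMap q 0 = 0 := by simp [doublingMap]
  simp only [h₀, genF_zero, mul_zero, sub_zero] at h
  linarith

end GeneralizedSine

/-- for `1 < q < ∞` and `x ∈ [0, π_{q/2,q}/2)`,
`cos_{2q/(q+2),q}(2^(2/q) x) = ((1 - (sin_{q/2,q} x)^q)/(1 + (sin_{q/2,q} x)^q))^(2/q+1)`. -/
theorem multiple_angle_cos2 (q : ℝ) (hq : 1 < q)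
    (x : ℝ) (hx0 : 0 ≤ x) (hx : ENNReal.ofReal x < genPi (q / 2) q / 2) :
    gcos (2 * q / (q + 2)) q ((2:ℝ) ^ (2 / q) * x) =
      ((1 - gsin (q / 2) q x ^ q) / (1 + gsin (q / 2) q x ^ q)) ^ (2 / q + 1) := by
  have hq₀ : 0 < q := by linarith
  obtain ⟨s, hs, rfl⟩ := exists_genF_eq (q / 2) hq₀ hx0 hx
  have h₁ := one_sub_rpow_pos_of_abs_lt_one hq₀ (Ico_zero_one_subset_Ioo hs)
  have h₂ : 0 < 1 + s ^ q := by have := hs.1; positivity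
  have e : (2 : ℝ) * (1 / (2 * q / (q + 2))) = 2 / q + 1 := by field_simp; ring
  rw [gsin_genF _ hq₀ hs, ← genF_doublingMap hq hs, gcos_genF _ hq₀ (doublingMap_mem hq₀ hs),
    one_sub_doublingMap_rpow hq₀ hs.1, ← Real.rpow_mul (by positivity), e]
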